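/- arXiv:1804.01121 — 3 statements merged into one kernel-verified Lean document; each statement's English description precedes it below -/
import Mathlib

section
/- Let K be a number field, let R ⊂ K be a Dedekind domain with O_K ⊆ R, let H be a finite-dimensional Hopf algebra over K, and let X be a Hopf order of H over R. If A is a Hopf subalgebra of H, then X ∩ A is a Hopf order of A over R. -/
open TensorProduct

noncomputable section


/-- The natural map `X ⊗[R] K → H` sending `x ⊗ c` to `c • x`. -/
noncomputable def ordNatMap (R K H : Type*) [CommRing R] [Field K]
    [Algebra R K] [AddCommGroup H] [Module K H] [Module R H] [IsScalarTower R K H]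
    (X : Submodule R H) : X ⊗[R] K →ₗ[R] H :=
  TensorProduct.lift
    { toFun := fun x => ((LinearMap.toSpanSingleton K H (x : H)).restrictScalars R)
      map_add' := by intro x y; ext c; simp [smul_add]
      map_smul' := by
        intro r x
        ext c
        simp only [LinearMap.coe_restrictScalars, LinearMap.toSpanSingleton_apply,
          LinearMap.smul_apply, SetLike.val_smul]
        rw [smul_comm]; rfl }

/-- The `R`-submodule of `H ⊗[K] H` spanned by elementary tensors `a ⊗ b` with
`a ∈ X`, `b ∈ Y`; this is the image of `X ⊗[R] Y` in `H ⊗[K] H`. -/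
def spanPairs (R K H : Type*) [CommRing R] [Field K]
    [Algebra R K] [AddCommGroup H] [Module K H] [Module R H] [IsScalarTower R K H]
    (X Y : Submodule R H) : Submodule R (H ⊗[K] H) :=
  Submodule.span R {z : H ⊗[K] H | ∃ a ∈ X, ∃ b ∈ Y, z = a ⊗ₜ[K] b}

/-- `X` is a Hopf order, over the subring `R` of `K`, of the subspace `W` of `V`, where
`V` carries (possibly twisted) Hopf-algebra structure maps `one`, `mul`, `Δ`, `ε`, `S`:
`X` is a finitely generated projective `R`-submodule with `X ⊗_R K ≅ W` naturally
(injectivity of the natural map plus `span_K X = W`), containing `one`, closed under `mul`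
and the antipode `S`, with `Δ(X) ⊆ X ⊗_R X` and `ε(X) ⊆ R`. -/
structure IsHopfOrderWith (R K V : Type*) [CommRing R] [Field K]
    [Algebra R K] [AddCommGroup V] [Module K V] [Module R V] [IsScalarTower R K V]
    (one : V) (mul : V → V → V) (W : Submodule K V)
    (Δ : V → V ⊗[K] V) (ε : V → K) (S : V → V) (X : Submodule R V) : Prop where
  fg : X.FG
  projective : Module.Projective R X
  inj : Function.Injective (ordNatMap R K V X)
  span_eq : Submodule.span K (X : Set V) = W
  one_mem : one ∈ X
  mul_mem : ∀ x ∈ X, ∀ y ∈ X, mul x y ∈ X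
  comul_mem : ∀ x ∈ X, Δ x ∈ spanPairs R K V X X
  counit_mem : ∀ x ∈ X, ε x ∈ Set.range (algebraMap R K)
  antipode_mem : ∀ x ∈ X, S x ∈ X


lemma aux_isFractionRing (K : Type*) [Field K] [NumberField K]
    (R : Type*) [CommRing R] [IsDomain R] [Algebra R K]
    (hR : Function.Injective (algebraMap R K))
    (hOK : ∀ x : K, IsIntegral ℤ x → x ∈ (algebraMap R K).range) : IsFractionRing R K := by
  have : FaithfulSMul R K := (faithfulSMul_iff_algebraMap_injective R K).mpr hR
  refine IsFractionRing.of_field R K ?_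
  intro z
  obtain ⟨x, y, hy, rfl⟩ := IsFractionRing.div_surjective (A := NumberField.RingOfIntegers K) z
  obtain ⟨a, ha⟩ := hOK _ (NumberField.RingOfIntegers.isIntegral_coe x)
  obtain ⟨b, hb⟩ := hOK _ (NumberField.RingOfIntegers.isIntegral_coe y)
  exact ⟨a, b, by rw [ha, hb]⟩

section aux
variable {R K V : Type*} [CommRing R] [IsDedekindDomain R] [Field K]
    [Algebra R K] [IsFractionRing R K] [AddCommGroup V] [Module K V] [Module R V]
    [IsScalarTower R K V]

lemma aux_torsionFree (R K V : Type*) [CommRing R] [IsDedekindDomain R] [Field K]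
    [Algebra R K] [IsFractionRing R K] [AddCommGroup V] [Module K V] [Module R V]
    [IsScalarTower R K V] : Module.IsTorsionFree R V := by
  refine ⟨fun r hr v w h => ?_⟩
  have h0 : algebraMap R K r ≠ 0 := by
    simpa using hr.ne_zero
  simp only [← algebraMap_smul K r] at h
  exact smul_right_injective V h0 h

lemma aux_denom (X : Submodule R V) (v : V) (hv : v ∈ Submodule.span K (X : Set V)) :
    ∃ r : nonZeroDivisors R, (r : R) • v ∈ X := by
  induction hv using Submodule.span_induction with
  | mem x h => exact ⟨1, by simpa using h⟩
  | zero => exact ⟨1, by simp⟩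
  | add x y _ _ hx hy =>
    obtain ⟨r, hr⟩ := hx
    obtain ⟨s, hs⟩ := hy
    refine ⟨r * s, ?_⟩
    rw [smul_add]
    refine X.add_mem ?_ ?_
    · rw [mul_comm, Submonoid.coe_mul, mul_smul]; exact X.smul_mem _ hr
    · rw [Submonoid.coe_mul, mul_smul]; exact X.smul_mem _ hs
  | smul c x _ hx =>
    obtain ⟨r, hr⟩ := hx
    obtain ⟨⟨a, s⟩, h⟩ := IsLocalization.surj (nonZeroDivisors R) c
    refine ⟨s * r, ?_⟩
    have : ((s * r : nonZeroDivisors R) : R) • c • x = a • (r : R) • x := by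
      simp only [← algebraMap_smul K (_ : R) (_ : V), smul_smul, Submonoid.coe_mul, map_mul]
      congr 1
      simp only at h
      rw [← h]; ring
    rw [this]
    exact X.smul_mem _ hr

lemma aux_loc (X : Submodule R V) (hX : Submodule.span K (X : Set V) = ⊤) :
    IsLocalizedModule (nonZeroDivisors R) X.subtype where
  map_units r := by
    have h := IsLocalization.map_units K r
    rw [Module.End.isUnit_iff]
    have h0 : algebraMap R K r ≠ 0 := h.ne_zero
    have key : ∀ v : V, algebraMap R (Module.End R V) r v = algebraMap R K r • v := by
      intro v; simp
    constructor
    · intro v w hvw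
      rw [key, key] at hvw
      exact (smul_right_injective V h0) hvw
    · intro v
      exact ⟨(algebraMap R K r)⁻¹ • v, by rw [key, smul_smul, mul_inv_cancel₀ h0, one_smul]⟩
  surj v := by
    obtain ⟨r, hr⟩ := aux_denom X v (hX ▸ Submodule.mem_top)
    exact ⟨⟨⟨_, hr⟩, r⟩, rfl⟩
  exists_of_eq h := ⟨1, by rw [Subtype.ext h]⟩

lemma aux_proj (X : Submodule R V) (hfg : X.FG) (hX : Submodule.span K (X : Set V) = ⊤)
    (W : Submodule K V) :
    ∃ P : V →ₗ[K] V, (∀ x ∈ X, P x ∈ X ⊓ W.restrictScalars R) ∧ ∀ w ∈ W, P w = w := by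
  have := aux_loc X hX
  have : Module.Finite R X := Module.Finite.iff_fg.mpr hfg
  let g : X →ₗ[R] V ⧸ W := (W.mkQ.restrictScalars R) ∘ₗ X.subtype
  have : Module.IsTorsionFree R (V ⧸ W) := aux_torsionFree R K _
  have : Module.FinitePresentation R (LinearMap.range g) :=
    Module.finitePresentation_of_finite R _
  have : Module.Projective R (LinearMap.range g) :=
    Module.Flat.projective_of_finitePresentation
  obtain ⟨s, hs⟩ := Module.projective_lifting_property g.rangeRestrict LinearMap.id
    g.surjective_rangeRestrict
  have hg : ∀ x : X, g x = 0 ↔ (x : V) ∈ W := by intro x; simp [g]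
  let p : X →ₗ[R] X := LinearMap.id - s ∘ₗ g.rangeRestrict
  have hp : ∀ x, g (p x) = 0 := by
    intro x
    have h := congrArg Subtype.val (LinearMap.congr_fun hs (g.rangeRestrict x))
    simp only [LinearMap.comp_apply, LinearMap.id_apply] at h
    change g (x - s (g.rangeRestrict x)) = 0
    rw [map_sub, sub_eq_zero]
    exact h.symm
  have hp' : ∀ x : X, (x : V) ∈ W → p x = x := by
    intro x hx
    have : g.rangeRestrict x = 0 := Subtype.ext ((hg x).2 hx)
    simp [p, this]
  let P : V →ₗ[K] V :=
    IsLocalizedModule.mapExtendScalars (nonZeroDivisors R) X.subtype X.subtype K p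
  have hP : ∀ x : X, P x = p x := by
    intro x
    exact IsLocalizedModule.map_apply (nonZeroDivisors R) X.subtype X.subtype p x
  refine ⟨P, ?_, ?_⟩
  · intro x hx
    rw [hP ⟨x, hx⟩]
    exact ⟨(p _).2, (hg _).1 (hp _)⟩
  · intro w hw
    obtain ⟨r, hr⟩ := aux_denom X w (hX ▸ Submodule.mem_top)
    have h0 : algebraMap R K r ≠ 0 := (IsLocalization.map_units K r).ne_zero
    have hrw : (r : R) • w ∈ W := by
      rw [← algebraMap_smul K]; exact W.smul_mem _ hw
    have h := hP ⟨_, hr⟩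
    rw [hp' _ hrw] at h
    simp only [← algebraMap_smul K (r : R) w, map_smul] at h
    exact smul_right_injective V h0 h

lemma aux_map_pairs (X Y : Submodule R V) (P : V →ₗ[K] V) (hP : ∀ x ∈ X, P x ∈ Y)
    (z : V ⊗[K] V) (hz : z ∈ spanPairs R K V X X) :
    TensorProduct.map P P z ∈ spanPairs R K V Y Y := by
  unfold spanPairs at hz
  induction hz using Submodule.span_induction with
  | mem x h =>
    obtain ⟨a, ha, b, hb, rfl⟩ := h
    exact Submodule.subset_span ⟨_, hP a ha, _, hP b hb, by simp⟩
  | zero => simp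
  | add x y _ _ hx hy => rw [map_add]; exact Submodule.add_mem _ hx hy
  | smul c x _ hx =>
    rw [← algebraMap_smul K c x, map_smul, algebraMap_smul]
    exact Submodule.smul_mem _ _ hx

lemma aux_map_id (W : Submodule K V) (P : V →ₗ[K] V) (hP : ∀ x ∈ W, P x = x)
    (z : V ⊗[K] V) (hz : z ∈ spanPairs K K V W W) :
    TensorProduct.map P P z = z := by
  unfold spanPairs at hz
  induction hz using Submodule.span_induction with
  | mem x h =>
    obtain ⟨a, ha, b, hb, rfl⟩ := h
    simp [hP a ha, hP b hb]
  | zero => simp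
  | add x y _ _ hx hy => rw [map_add, hx, hy]
  | smul c x _ hx => rw [map_smul, hx]

lemma aux_inj (X Y : Submodule R V) (h : Y ≤ X)
    (hX : Function.Injective (ordNatMap R K V X)) :
    Function.Injective (ordNatMap R K V Y) := by
  have : Module.Flat R K := IsLocalization.flat K (nonZeroDivisors R)
  have h1 : ordNatMap R K V Y = ordNatMap R K V X ∘ₗ (Submodule.inclusion h).rTensor K := by
    ext y; simp [ordNatMap]
  rw [h1, LinearMap.coe_comp]
  exact hX.comp (Module.Flat.rTensor_preserves_injective_linearMap _
    (Submodule.inclusion_injective h))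

end aux

/-- **Hopf orders restrict to Hopf subalgebras** (Proposition 1.1(iii) of Cuadra–Meir).
Let `K` be a number field, `R ⊂ K` a Dedekind domain with `𝓞_K ⊆ R`, `H` a
finite-dimensional Hopf algebra over `K` and `X` a Hopf order of `H` over `R`.  If `A` is a
Hopf subalgebra of `H` (a subalgebra with `Δ(A) ⊆ A ⊗ A` and `S(A) ⊆ A`), then `X ∩ A` is
a Hopf order of `A` over `R`. -/
theorem hopfOrder_inf_hopfSubalgebra
    (K : Type*) [Field K] [NumberField K]
    (R : Type*) [CommRing R] [IsDedekindDomain R] [Algebra R K]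
    (hR : Function.Injective (algebraMap R K))
    (hOK : ∀ x : K, IsIntegral ℤ x → x ∈ (algebraMap R K).range)
    (H : Type*) [Ring H] [HopfAlgebra K H] [FiniteDimensional K H]
    [Module R H] [IsScalarTower R K H]
    (X : Submodule R H)
    (hX : IsHopfOrderWith R K H 1 (· * ·) ⊤
      (Coalgebra.comul (R := K) (A := H)) (Coalgebra.counit (R := K) (A := H))
      (HopfAlgebra.antipode (R := K) (A := H)) X)
    (A : Subalgebra K H)
    (hAcomul : ∀ a ∈ A, Coalgebra.comul (R := K) (A := H) a ∈
      spanPairs K K H (Subalgebra.toSubmodule A) (Subalgebra.toSubmodule A))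
    (hAantipode : ∀ a ∈ A, HopfAlgebra.antipode (R := K) (A := H) a ∈ A) :
    IsHopfOrderWith R K H 1 (· * ·) (Subalgebra.toSubmodule A)
      (Coalgebra.comul (R := K) (A := H)) (Coalgebra.counit (R := K) (A := H))
      (HopfAlgebra.antipode (R := K) (A := H))
      (X ⊓ Submodule.restrictScalars R (Subalgebra.toSubmodule A)) := by
  have := aux_isFractionRing K R hR hOK
  have : Module.IsTorsionFree R H := aux_torsionFree R K H
  obtain ⟨P, hP1, hP2⟩ := aux_proj X hX.fg hX.span_eq (Subalgebra.toSubmodule A)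
  have hfX : Module.Finite R X := Module.Finite.iff_fg.mpr hX.fg
  have hfg : (X ⊓ Submodule.restrictScalars R (Subalgebra.toSubmodule A)).FG :=
    hX.fg.of_le inf_le_left
  have hfin := Module.Finite.iff_fg.mpr hfg
  refine ⟨hfg, ?_, aux_inj X _ inf_le_left hX.inj, ?_, ⟨hX.one_mem, A.one_mem⟩, ?_, ?_, ?_, ?_⟩
  · have := Module.finitePresentation_of_finite R
      (X ⊓ Submodule.restrictScalars R (Subalgebra.toSubmodule A) : Submodule R H)
    exact Module.Flat.projective_of_finitePresentation
  · apply le_antisymm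
    · exact Submodule.span_le.2 fun x hx => hx.2
    · intro a ha
      obtain ⟨r, hr⟩ := aux_denom (K := K) X a (hX.span_eq ▸ Submodule.mem_top)
      have h0 : algebraMap R K r ≠ 0 := (IsLocalization.map_units K r).ne_zero
      have hra : (r : R) • a ∈ X ⊓ Submodule.restrictScalars R (Subalgebra.toSubmodule A) :=
        ⟨hr, Submodule.smul_mem (Submodule.restrictScalars R (Subalgebra.toSubmodule A)) _ ha⟩
      have h2 := Submodule.smul_mem _ (algebraMap R K r)⁻¹ (Submodule.subset_span (R := K) hra)
      rwa [← algebraMap_smul K (r : R) a, smul_smul, inv_mul_cancel₀ h0, one_smul] at h2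
  · exact fun x hx y hy => ⟨hX.mul_mem x hx.1 y hy.1, A.mul_mem hx.2 hy.2⟩
  · intro x hx
    rw [← aux_map_id _ P hP2 _ (hAcomul x hx.2)]
    exact aux_map_pairs X _ P hP1 _ (hX.comul_mem x hx.1)
  · exact fun x hx => hX.counit_mem x hx.1
  · exact fun x hx => ⟨hX.antipode_mem x hx.1, hAantipode x hx.2⟩

end
end

section
/- Let K be a number field, let R ⊂ K be a Dedekind domain with O_K ⊆ R, let H be a finite-dimensional Hopf algebra over K, and let X be a Hopf order of H over R. If π : H → B is a surjective Hopf algebra map onto a Hopf algebra B over K, then π(X) is a Hopf order of B over R. -/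
open TensorProduct

noncomputable section


theorem aux_frac (K : Type*) [Field K] [NumberField K] (R : Type*) [CommRing R] [Algebra R K]
    (hOK : ∀ x : K, IsIntegral ℤ x → x ∈ (algebraMap R K).range) (c : K) :
    ∃ n : ℤ, (n : K) ≠ 0 ∧ ∃ r : R, algebraMap R K r = n * c := by
  have halg : IsAlgebraic ℤ c :=
    (IsFractionRing.isAlgebraic_iff ℤ ℚ K).2 (Algebra.IsAlgebraic.isAlgebraic c)
  obtain ⟨n, hn, h⟩ := halg.exists_integral_multiple
  obtain ⟨r, hr⟩ := hOK _ h
  exact ⟨n, by exact_mod_cast hn, r, by rw [hr, zsmul_eq_mul]⟩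

theorem aux_pure (K : Type*) [Field K] [NumberField K] (R : Type*) [CommRing R] [Algebra R K]
    (hOK : ∀ x : K, IsIntegral ℤ x → x ∈ (algebraMap R K).range)
    (M : Type*) [AddCommGroup M] [Module R M] (t : M ⊗[R] K) :
    ∃ (x : M) (c : K), t = x ⊗ₜ[R] c := by
  induction t using TensorProduct.induction_on with
  | zero => exact ⟨0, 0, by simp⟩
  | tmul x c => exact ⟨x, c, rfl⟩
  | add t u ht hu =>
    obtain ⟨x, a, rfl⟩ := ht
    obtain ⟨y, b, rfl⟩ := hu
    obtain ⟨n, hn, r, hr⟩ := aux_frac K R hOK a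
    obtain ⟨m, hm, s, hs⟩ := aux_frac K R hOK b
    refine ⟨((m : R) * r) • x + ((n : R) * s) • y, ((n : K) * m)⁻¹, ?_⟩
    have ha : a = ((m : R) * r) • ((n : K) * m)⁻¹ := by
      rw [Algebra.smul_def, map_mul, hr, map_intCast]; field_simp
    have hb : b = ((n : R) * s) • ((n : K) * m)⁻¹ := by
      rw [Algebra.smul_def, map_mul, hs, map_intCast]; field_simp
    rw [TensorProduct.add_tmul, TensorProduct.smul_tmul, TensorProduct.smul_tmul, ← ha, ← hb]

/-- **Hopf orders project onto quotient Hopf algebras** (Proposition 1.1(iv) of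
Cuadra–Meir).  Let `K` be a number field, `R ⊂ K` a Dedekind domain with `𝓞_K ⊆ R`, `H` a
finite-dimensional Hopf algebra over `K` and `X` a Hopf order of `H` over `R`.  If
`π : H → B` is a surjective Hopf algebra map, then `π(X)` is a Hopf order of `B` over
`R`. -/
theorem hopfOrder_map_of_surjective
    (K : Type*) [Field K] [NumberField K]
    (R : Type*) [CommRing R] [IsDedekindDomain R] [Algebra R K]
    (hR : Function.Injective (algebraMap R K))
    (hOK : ∀ x : K, IsIntegral ℤ x → x ∈ (algebraMap R K).range)
    (H : Type*) [Ring H] [HopfAlgebra K H] [FiniteDimensional K H]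
    [Module R H] [IsScalarTower R K H]
    (B : Type*) [Ring B] [HopfAlgebra K B]
    [Module R B] [IsScalarTower R K B]
    (X : Submodule R H)
    (hX : IsHopfOrderWith R K H 1 (· * ·) ⊤
      (Coalgebra.comul (R := K) (A := H)) (Coalgebra.counit (R := K) (A := H))
      (HopfAlgebra.antipode (R := K) (A := H)) X)
    (π : H →ₐ[K] B) (hsurj : Function.Surjective π)
    (hπcomul : ∀ h : H, Coalgebra.comul (R := K) (A := B) (π h) =
      TensorProduct.map π.toLinearMap π.toLinearMap (Coalgebra.comul (R := K) (A := H) h))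
    (hπcounit : ∀ h : H,
      Coalgebra.counit (R := K) (A := B) (π h) = Coalgebra.counit (R := K) (A := H) h)
    (hπantipode : ∀ h : H,
      HopfAlgebra.antipode (R := K) (A := B) (π h) =
        π (HopfAlgebra.antipode (R := K) (A := H) h)) :
    IsHopfOrderWith R K B 1 (· * ·) ⊤
      (Coalgebra.comul (R := K) (A := B)) (Coalgebra.counit (R := K) (A := B))
      (HopfAlgebra.antipode (R := K) (A := B))
      (Submodule.map (π.toLinearMap.restrictScalars R) X) := by
  refine ⟨hX.fg.map _, ?_, ?_, ?_, ?_, ?_, ?_, ?_, ?_⟩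
  · have htf : Module.IsTorsionFree R B := by
      have : Module.IsTorsionFree R K := by
        rw [Module.isTorsionFree_iff_algebraMap_injective]
        exact hR
      exact Module.IsTorsionFree.trans_faithfulSMul R K B
    have hfin : Module.Finite R (Submodule.map (π.toLinearMap.restrictScalars R) X) :=
      Module.Finite.iff_fg.2 (hX.fg.map _)
    have : Module.FinitePresentation R (Submodule.map (π.toLinearMap.restrictScalars R) X) :=
      Module.finitePresentation_of_finite R _
    exact Module.Flat.projective_of_finitePresentation
  · rw [injective_iff_map_eq_zero]
    intro t ht
    obtain ⟨x, c, rfl⟩ := aux_pure K R hOK _ t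
    have h : c • (x : B) = 0 := ht
    rcases smul_eq_zero.1 h with h | h
    · rw [h, TensorProduct.tmul_zero]
    · rw [Subtype.ext (a1 := x) (a2 := 0) h, TensorProduct.zero_tmul]
  · have : ((Submodule.map (π.toLinearMap.restrictScalars R) X : Submodule R B) : Set B)
        = π.toLinearMap '' (X : Set H) := rfl
    rw [this, ← Submodule.map_span, hX.span_eq, Submodule.map_top]
    exact LinearMap.range_eq_top.2 hsurj
  · exact ⟨1, hX.one_mem, map_one π⟩
  · rintro _ ⟨x, hx, rfl⟩ _ ⟨y, hy, rfl⟩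
    exact ⟨x * y, hX.mul_mem x hx y hy, map_mul π x y⟩
  · rintro _ ⟨x, hx, rfl⟩
    change Coalgebra.comul (R := K) (A := B) (π x) ∈ _
    rw [hπcomul]
    have h := hX.comul_mem x hx
    generalize (Coalgebra.comul (R := K) (A := H)) x = z at h
    unfold spanPairs at h ⊢
    induction h using Submodule.span_induction with
    | mem z hz =>
      obtain ⟨a, ha, b, hb, rfl⟩ := hz
      exact Submodule.subset_span ⟨π a, ⟨a, ha, rfl⟩, π b, ⟨b, hb, rfl⟩, by simp⟩
    | zero => simp
    | add u v _ _ hu hv => rw [map_add]; exact add_mem hu hv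
    | smul r u _ hu =>
      rw [← algebraMap_smul K r u, map_smul, algebraMap_smul]
      exact Submodule.smul_mem _ r hu
  · rintro _ ⟨x, hx, rfl⟩
    change Coalgebra.counit (R := K) (A := B) (π x) ∈ _
    rw [hπcounit]
    exact hX.counit_mem x hx
  · rintro _ ⟨x, hx, rfl⟩
    exact ⟨_, hX.antipode_mem x hx, (hπantipode x).symm⟩

end
end

section
/- Let H be a Hopf algebra over a field K, let J ∈ H ⊗ H be a twist for H, let R be a subring of K, and let X be a Hopf order of H over R. If both J and J^{-1} belong to X ⊗_R X, then X is a Hopf order over R of the twisted Hopf algebra H_J. -/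
open TensorProduct

noncomputable section


/-- `J ∈ H ⊗ H` is a (Drinfel'd) twist for the bialgebra `H`: it is invertible and satisfies
`(1 ⊗ J)(id ⊗ Δ)(J) = (J ⊗ 1)(Δ ⊗ id)(J)` and `(ε ⊗ id)(J) = (id ⊗ ε)(J) = 1`. -/
def IsTwist (K H : Type*) [CommRing K] [Ring H] [Bialgebra K H]
    (J : H ⊗[K] H) : Prop :=
  IsUnit J ∧
  ((1 : H) ⊗ₜ[K] J) * (LinearMap.lTensor H (Coalgebra.comul (R := K) (A := H)) J) =
    (TensorProduct.assoc K H H H)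
      ((J ⊗ₜ[K] (1 : H)) * (LinearMap.rTensor H (Coalgebra.comul (R := K) (A := H)) J)) ∧
  (TensorProduct.lid K H) (LinearMap.rTensor H (Coalgebra.counit (R := K) (A := H)) J) = 1 ∧
  (TensorProduct.rid K H) (LinearMap.lTensor H (Coalgebra.counit (R := K) (A := H)) J) = 1

/-- The element `U_J = Σ J⁽¹⁾ S(J⁽²⁾)` associated to a twist `J`. -/
def twistU (K H : Type*) [CommRing K] [Ring H] [HopfAlgebra K H]
    (J : H ⊗[K] H) : H :=
  LinearMap.mul' K H (LinearMap.lTensor H (HopfAlgebra.antipode (R := K) (A := H)) J)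


theorem aux_span_map {R K M N : Type*} [CommRing R] [Field K] [Algebra R K]
    [AddCommGroup M] [Module K M] [Module R M] [IsScalarTower R K M]
    [AddCommGroup N] [Module K N] [Module R N] [IsScalarTower R K N]
    (f : M →ₗ[K] N) (s : Set M) (Y : Submodule R N) (h : ∀ x ∈ s, f x ∈ Y)
    (x : M) (hx : x ∈ Submodule.span R s) : f x ∈ Y := by
  have : Submodule.span R s ≤ Y.comap (f.restrictScalars R) := Submodule.span_le.2 h
  exact this hx

theorem aux_mul_mem {K H R : Type*} [Field K] [Ring H] [Algebra K H]
    [CommRing R] [Algebra R K] [Module R H] [IsScalarTower R K H]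
    (X : Submodule R H) (hX : ∀ x ∈ X, ∀ y ∈ X, x * y ∈ X)
    (a b : H ⊗[K] H) (ha : a ∈ spanPairs R K H X X) (hb : b ∈ spanPairs R K H X X) :
    a * b ∈ spanPairs R K H X X := by
  refine aux_span_map (LinearMap.mulRight K b) _ _ ?_ a ha
  rintro _ ⟨x, hx, y, hy, rfl⟩
  refine aux_span_map (LinearMap.mulLeft K (x ⊗ₜ[K] y)) _ _ ?_ b hb
  rintro _ ⟨z, hz, w, hw, rfl⟩
  refine Submodule.subset_span ⟨x * z, hX _ hx _ hz, y * w, hX _ hy _ hw, ?_⟩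
  simp

/-- `a ⊗ (b ⊗ c) ↦ S(a) b S(c)`. -/
def auxPhi (K H : Type*) [Field K] [Ring H] [HopfAlgebra K H] :
    H ⊗[K] (H ⊗[K] H) →ₗ[K] H :=
  LinearMap.mul' K H ∘ₗ TensorProduct.map (HopfAlgebra.antipode (R := K) (A := H))
    (LinearMap.mul' K H ∘ₗ LinearMap.lTensor H (HopfAlgebra.antipode (R := K) (A := H)))

/-- `Σ S(I¹) I²`. -/
def auxV (K H : Type*) [Field K] [Ring H] [HopfAlgebra K H] (I : H ⊗[K] H) : H :=
  LinearMap.mul' K H (LinearMap.rTensor H (HopfAlgebra.antipode (R := K) (A := H)) I)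

theorem auxPhi_left {K H : Type*} [Field K] [Ring H] [HopfAlgebra K H] (I J : H ⊗[K] H) :
    auxPhi K H ((TensorProduct.assoc K H H H) (I ⊗ₜ[K] (1 : H)) * ((1 : H) ⊗ₜ[K] J)) =
      auxV K H I * twistU K H J := by
  induction I with
  | zero => simp [auxV]
  | add a b ha hb =>
    simp only [auxV, TensorProduct.add_tmul, map_add, add_mul] at *
    rw [ha, hb]
  | tmul a b =>
    induction J with
    | zero => simp [twistU]
    | add c d hc hd =>
      simp only [twistU, TensorProduct.tmul_add, map_add, mul_add] at *
      rw [hc, hd]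
    | tmul c d => simp [auxPhi, auxV, twistU, mul_assoc]

theorem auxPhi_right1 {K H : Type*} [Field K] [Ring H] [HopfAlgebra K H]
    (w z : H ⊗[K] H) (y p : H) :
    auxPhi K H ((TensorProduct.assoc K H H H) (w ⊗ₜ[K] y) * (p ⊗ₜ[K] z)) =
      HopfAlgebra.antipode K p * (auxV K H w * twistU K H z) * HopfAlgebra.antipode K y := by
  induction w with
  | zero => simp [auxV]
  | add a b ha hb =>
    simp only [auxV, TensorProduct.add_tmul, map_add, add_mul, mul_add] at *
    rw [ha, hb]
  | tmul a b =>
    induction z with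
    | zero => simp [twistU]
    | add c d hc hd =>
      simp only [twistU, TensorProduct.tmul_add, map_add, mul_add, add_mul] at *
      rw [hc, hd]
    | tmul c d =>
      simp [auxPhi, auxV, twistU, mul_assoc, HopfAlgebra.antipode_mul_antidistrib]

theorem auxPhi_right {K H : Type*} [Field K] [Ring H] [HopfAlgebra K H] (I J : H ⊗[K] H) :
    auxPhi K H ((TensorProduct.assoc K H H H)
        (LinearMap.rTensor H (Coalgebra.comul (R := K) (A := H)) J) *
        (LinearMap.lTensor H (Coalgebra.comul (R := K) (A := H)) I)) =
      HopfAlgebra.antipode K ((TensorProduct.rid K H)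
        (LinearMap.lTensor H (Coalgebra.counit (R := K) (A := H)) I)) *
      HopfAlgebra.antipode K ((TensorProduct.lid K H)
        (LinearMap.rTensor H (Coalgebra.counit (R := K) (A := H)) J)) := by
  induction I with
  | zero => simp
  | add a b ha hb =>
    simp only [map_add, add_mul, mul_add] at *
    rw [ha, hb]
  | tmul p q =>
    induction J with
    | zero => simp
    | add c d hc hd =>
      simp only [map_add, mul_add, add_mul] at *
      rw [hc, hd]
    | tmul x y =>
      rw [LinearMap.rTensor_tmul, LinearMap.lTensor_tmul, auxPhi_right1]
      simp [auxV, twistU, Algebra.algebraMap_eq_smul_one, smul_smul, mul_comm]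

theorem aux_VU {K H : Type*} [Field K] [Ring H] [HopfAlgebra K H] (I J : H ⊗[K] H)
    (hJ : IsTwist K H J) (hIJ : I * J = 1) (hJI : J * I = 1) :
    auxV K H I * twistU K H J = 1 := by
  obtain ⟨-, h1, h2, h3⟩ := hJ
  have e1 : ∀ x, (Algebra.TensorProduct.assoc K K K H H H) x = TensorProduct.assoc K H H H x :=
    fun x => rfl
  have e2 : ∀ x, (Algebra.TensorProduct.map (AlgHom.id K H) (Bialgebra.comulAlgHom K H)) x =
    LinearMap.lTensor H (Coalgebra.comul (R := K) (A := H)) x := fun x => rfl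
  have e3 : ∀ x, (Algebra.TensorProduct.map (AlgHom.id K H) (Bialgebra.counitAlgHom K H)) x =
    LinearMap.lTensor H (Coalgebra.counit (R := K) (A := H)) x := fun x => rfl
  have e4 : ∀ x, (Algebra.TensorProduct.rid K K H) x = TensorProduct.rid K H x := fun x => rfl
  have hB : LinearMap.lTensor H (Coalgebra.comul (R := K) (A := H)) J *
      LinearMap.lTensor H (Coalgebra.comul (R := K) (A := H)) I = 1 := by
    rw [← e2, ← e2, ← map_mul, hJI, map_one]
  have hC : (TensorProduct.assoc K H H H) (I ⊗ₜ[K] (1 : H)) *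
      (TensorProduct.assoc K H H H) (J ⊗ₜ[K] (1 : H)) = 1 := by
    rw [← e1, ← e1, ← map_mul, Algebra.TensorProduct.tmul_mul_tmul, hIJ, one_mul]
    exact map_one _
  have hI : (TensorProduct.rid K H)
      (LinearMap.lTensor H (Coalgebra.counit (R := K) (A := H)) I) = 1 := by
    have : (TensorProduct.rid K H)
      (LinearMap.lTensor H (Coalgebra.counit (R := K) (A := H)) (I * J)) = 1 := by
      rw [hIJ, ← e3, ← e4, map_one, map_one]
    rwa [← e3, ← e4, map_mul, map_mul, e3 J, e4 (LinearMap.lTensor H _ J), h3, mul_one,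
      e3, e4] at this
  rw [← e1, map_mul, e1, e1] at h1
  have key : (TensorProduct.assoc K H H H) (I ⊗ₜ[K] (1 : H)) * ((1 : H) ⊗ₜ[K] J) =
      (TensorProduct.assoc K H H H)
        (LinearMap.rTensor H (Coalgebra.comul (R := K) (A := H)) J) *
        (LinearMap.lTensor H (Coalgebra.comul (R := K) (A := H)) I) := by
    have := congrArg (fun t => (TensorProduct.assoc K H H H) (I ⊗ₜ[K] (1 : H)) * t *
      LinearMap.lTensor H (Coalgebra.comul (R := K) (A := H)) I) h1
    rw [mul_assoc, mul_assoc, hB, mul_one, ← mul_assoc, hC, one_mul] at this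
    exact this
  rw [← auxPhi_left, key, auxPhi_right, hI, h2]
  simp

/-- **Twisting Hopf orders** (Proposition 2.5 of Cuadra–Meir).  Let `H` be a Hopf algebra
over a field `K`, `J` a twist for `H`, `R` a subring of `K` and `X` a Hopf order of `H`
over `R`.  If `J` and `J⁻¹` belong to `X ⊗_R X`, then `X` is a Hopf order of the twisted
Hopf algebra `H_J` (same algebra structure, coproduct `Δ_J h = J Δ(h) J⁻¹` and antipode
`S_J h = U_J S(h) U_J⁻¹`). -/
theorem hopfOrder_of_twist
    (K H : Type*) [Field K] [Ring H] [HopfAlgebra K H]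
    (R : Type*) [CommRing R] [Algebra R K] (hR : Function.Injective (algebraMap R K))
    [Module R H] [IsScalarTower R K H]
    (J : H ⊗[K] H) (hJ : IsTwist K H J)
    (X : Submodule R H)
    (hX : IsHopfOrderWith R K H 1 (· * ·) ⊤
      (Coalgebra.comul (R := K) (A := H)) (Coalgebra.counit (R := K) (A := H))
      (HopfAlgebra.antipode (R := K) (A := H)) X)
    (hJX : J ∈ spanPairs R K H X X)
    (hJinvX : Ring.inverse J ∈ spanPairs R K H X X) :
    IsHopfOrderWith R K H 1 (· * ·) ⊤
      (fun h => J * Coalgebra.comul (R := K) (A := H) h * Ring.inverse J)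
      (Coalgebra.counit (R := K) (A := H))
      (fun h => twistU K H J * HopfAlgebra.antipode (R := K) (A := H) h *
        Ring.inverse (twistU K H J))
      X := by
  have hIJ : Ring.inverse J * J = 1 := Ring.inverse_mul_cancel J hJ.1
  have hJI : J * Ring.inverse J = 1 := Ring.mul_inverse_cancel J hJ.1
  have hVU := aux_VU (Ring.inverse J) J hJ hIJ hJI
  have hU : twistU K H J ∈ X := by
    refine aux_span_map (LinearMap.mul' K H ∘ₗ
      LinearMap.lTensor H (HopfAlgebra.antipode (R := K) (A := H))) _ X ?_ J hJX
    rintro _ ⟨a, ha, b, hb, rfl⟩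
    simpa using hX.mul_mem _ ha _ (hX.antipode_mem _ hb)
  have hV : auxV K H (Ring.inverse J) ∈ X := by
    refine aux_span_map (LinearMap.mul' K H ∘ₗ
      LinearMap.rTensor H (HopfAlgebra.antipode (R := K) (A := H))) _ X ?_ _ hJinvX
    rintro _ ⟨a, ha, b, hb, rfl⟩
    simpa using hX.mul_mem _ (hX.antipode_mem _ ha) _ hb
  have hUinv : Ring.inverse (twistU K H J) ∈ X := by
    by_cases hu : IsUnit (twistU K H J)
    · have : Ring.inverse (twistU K H J) = auxV K H (Ring.inverse J) := by
        rw [← one_mul (Ring.inverse (twistU K H J)), ← hVU, mul_assoc,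
          Ring.mul_inverse_cancel _ hu, mul_one]
      rw [this]; exact hV
    · rw [Ring.inverse_non_unit _ hu]; exact X.zero_mem
  exact
    { fg := hX.fg
      projective := hX.projective
      inj := hX.inj
      span_eq := hX.span_eq
      one_mem := hX.one_mem
      mul_mem := hX.mul_mem
      comul_mem := fun x hx => aux_mul_mem X hX.mul_mem _ _
        (aux_mul_mem X hX.mul_mem _ _ hJX (hX.comul_mem x hx)) hJinvX
      counit_mem := hX.counit_mem
      antipode_mem := fun x hx => hX.mul_mem _
        (hX.mul_mem _ hU _ (hX.antipode_mem x hx)) _ hUinv }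

end
end
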